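/- Let X and Y be finite nonempty sets and let p ∈ 𝔓(X×Y) satisfy p(x,y) > 0 for all (x,y) ∈ X×Y. Then there exist no sequence (Γ_l)_{l∈ℕ} of finite nonempty sets and sequences of functions f_l : X^l → Γ_l, g_l : Y^l → Γ_l such that simultaneously: (1) lim_{l→∞} |Γ_l| = ∞; (2) lim_{l→∞} p^{⊗l}({(x^l,y^l) : f_l(x^l) = g_l(y^l)}) = 1; and (3) for every sequence (k_l)_{l∈ℕ} with k_l ∈ Γ_l for all l, both lim_{l→∞} p_X^{⊗l}({x^l : f_l(x^l) = k_l}) = 0 and lim_{l→∞} p_Y^{⊗l}({y^l : g_l(y^l) = k_l}) = 0. -/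

import Mathlib

open Filter

attribute [local instance] Classical.propDecidable

/-- A weight `w` on `α × β` with marginals `a` and `b` has maximal correlation at most `ρ`,
in quadratic form: `Cov(φ, ψ) ≤ ρ / 2 * (Var φ + Var ψ)` for all `φ` and `ψ`. -/
def CovarianceBound {α β : Type*} [Fintype α] [Fintype β] (ρ : ℝ)
    (a : α → ℝ) (b : β → ℝ) (w : α → β → ℝ) : Prop :=
  ∀ (φ : α → ℝ) (ψ : β → ℝ),
    ∑ x, ∑ y, w x y * (φ x * ψ y) - (∑ x, a x * φ x) * (∑ y, b y * ψ y) ≤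
      ρ / 2 * ((∑ x, a x * φ x ^ 2 - (∑ x, a x * φ x) ^ 2) +
        (∑ y, b y * ψ y ^ 2 - (∑ y, b y * ψ y) ^ 2))

theorem sum_weight_mul_left {α β : Type*} [Fintype α] [Fintype β] {a : α → ℝ}
    {w : α → β → ℝ} (ha : ∀ x, ∑ y, w x y = a x) (F : α → ℝ) :
    ∑ x, ∑ y, w x y * F x = ∑ x, a x * F x := by
  simp only [← Finset.sum_mul, ha]

theorem sum_weight_mul_right {α β : Type*} [Fintype α] [Fintype β] {b : β → ℝ}
    {w : α → β → ℝ} (hb : ∀ y, ∑ x, w x y = b y) (F : β → ℝ) :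
    ∑ x, ∑ y, w x y * F y = ∑ y, b y * F y := by
  rw [Finset.sum_comm]
  simp only [← Finset.sum_mul, hb]

/-- Second moment of `φ(x) - ψ(y) - c` under a weight with marginals `a` and `b`. -/
theorem sum_weight_mul_sub_sq {α β : Type*} [Fintype α] [Fintype β] {a : α → ℝ} {b : β → ℝ}
    {w : α → β → ℝ} (ha : ∀ x, ∑ y, w x y = a x) (hb : ∀ y, ∑ x, w x y = b y)
    (ha1 : ∑ x, a x = 1) (φ : α → ℝ) (ψ : β → ℝ) (c : ℝ) :
    ∑ x, ∑ y, w x y * (φ x - ψ y - c) ^ 2 =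
      ∑ x, a x * φ x ^ 2 + ∑ y, b y * ψ y ^ 2 - 2 * ∑ x, ∑ y, w x y * (φ x * ψ y) -
        2 * c * (∑ x, a x * φ x) + 2 * c * (∑ y, b y * ψ y) + c ^ 2 := by
  have h1 : ∑ x, ∑ y, w x y = 1 := by simp only [ha, ha1]
  rw [← sum_weight_mul_left ha (fun x => φ x ^ 2), ← sum_weight_mul_left ha φ,
    ← sum_weight_mul_right hb (fun y => ψ y ^ 2), ← sum_weight_mul_right hb ψ]
  conv_rhs => rw [← mul_one (c ^ 2), ← h1]
  simp only [Finset.mul_sum, ← Finset.sum_add_distrib, ← Finset.sum_sub_distrib]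
  refine Finset.sum_congr rfl fun x _ => Finset.sum_congr rfl fun y _ => ?_
  ring

theorem covarianceBound_of_le {α β : Type*} [Fintype α] [Fintype β] {ε : ℝ} {a : α → ℝ}
    {b : β → ℝ} {w : α → β → ℝ} (ha : ∀ x, ∑ y, w x y = a x) (hb : ∀ y, ∑ x, w x y = b y)
    (ha1 : ∑ x, a x = 1) (hb1 : ∑ y, b y = 1) (hw : ∀ x y, ε * (a x * b y) ≤ w x y) :
    CovarianceBound (1 - ε) a b w := by
  intro φ ψ
  have h1 := sum_weight_mul_sub_sq ha hb ha1 φ ψ (∑ x, a x * φ x - ∑ y, b y * ψ y)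
  have h2 := sum_weight_mul_sub_sq (w := fun x y => a x * b y) (a := a) (b := b)
    (fun x => by rw [← Finset.mul_sum, hb1, mul_one])
    (fun y => by rw [← Finset.sum_mul, ha1, one_mul]) ha1 φ ψ
    (∑ x, a x * φ x - ∑ y, b y * ψ y)
  have h3 : ∑ x, ∑ y, a x * b y * (φ x * ψ y) = (∑ x, a x * φ x) * (∑ y, b y * ψ y) := by
    rw [Finset.sum_mul_sum]
    exact Finset.sum_congr rfl fun x _ => Finset.sum_congr rfl fun y _ => by ring
  have h4 : ε * ∑ x, ∑ y, a x * b y * (φ x - ψ y - (∑ x, a x * φ x - ∑ y, b y * ψ y)) ^ 2 ≤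
      ∑ x, ∑ y, w x y * (φ x - ψ y - (∑ x, a x * φ x - ∑ y, b y * ψ y)) ^ 2 := by
    simp only [Finset.mul_sum]
    refine Finset.sum_le_sum fun x _ => Finset.sum_le_sum fun y _ => ?_
    rw [← mul_assoc]
    exact mul_le_mul_of_nonneg_right (hw x y) (sq_nonneg _)
  rw [h1, h2, h3] at h4
  linarith

/-- Tensorization of the covariance bound, stated for functions in curried form. -/
theorem CovarianceBound.tensor {α β α' β' : Type*} [Fintype α] [Fintype β] [Fintype α']
    [Fintype β'] {ρ : ℝ} {a : α → ℝ} {b : β → ℝ} {w : α → β → ℝ} {a' : α' → ℝ} {b' : β' → ℝ}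
    {w' : α' → β' → ℝ} (ha : ∀ x, ∑ y, w x y = a x) (hb : ∀ y, ∑ x, w x y = b y)
    (hw : ∀ x y, 0 ≤ w x y) (h : CovarianceBound ρ a b w) (h' : CovarianceBound ρ a' b' w')
    (φ : α → α' → ℝ) (ψ : β → β' → ℝ) :
    ∑ x, ∑ x', ∑ y, ∑ y', w x y * w' x' y' * (φ x x' * ψ y y') -
        (∑ x, ∑ x', a x * a' x' * φ x x') * (∑ y, ∑ y', b y * b' y' * ψ y y') ≤
      ρ / 2 * ((∑ x, ∑ x', a x * a' x' * φ x x' ^ 2 - (∑ x, ∑ x', a x * a' x' * φ x x') ^ 2) +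
        (∑ y, ∑ y', b y * b' y' * ψ y y' ^ 2 - (∑ y, ∑ y', b y * b' y' * ψ y y') ^ 2)) := by
  simp only [mul_assoc (a _), mul_assoc (b _), mul_assoc (w _ _), ← Finset.mul_sum]
  have hswap : ∑ x, ∑ x', ∑ y, w x y * ∑ y', w' x' y' * (φ x x' * ψ y y') =
      ∑ x, ∑ y, w x y * ∑ x', ∑ y', w' x' y' * (φ x x' * ψ y y') := by
    refine Finset.sum_congr rfl fun x _ => ?_
    rw [Finset.sum_comm]
    simp only [Finset.mul_sum]
  rw [hswap]
  have hmean := h (fun x => ∑ x', a' x' * φ x x') (fun y => ∑ y', b' y' * ψ y y')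
  have hcond := Finset.sum_le_sum fun x (_ : x ∈ Finset.univ) =>
    Finset.sum_le_sum fun y (_ : y ∈ Finset.univ) =>
      mul_le_mul_of_nonneg_left (h' (φ x) (ψ y)) (hw x y)
  simp only [mul_sub, mul_add, mul_left_comm (w _ _) (ρ / 2), Finset.sum_add_distrib,
    Finset.sum_sub_distrib, ← Finset.mul_sum] at hcond hmean ⊢
  rw [sum_weight_mul_left ha (fun x => ∑ x', a' x' * φ x x' ^ 2),
    sum_weight_mul_left ha (fun x => (∑ x', a' x' * φ x x') ^ 2),
    sum_weight_mul_right hb (fun y => ∑ y', b' y' * ψ y y' ^ 2),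
    sum_weight_mul_right hb (fun y => (∑ y', b' y' * ψ y y') ^ 2)] at hcond
  linarith

theorem sum_fin_succ_pi {α : Type*} [Fintype α] (n : ℕ) (F : (Fin (n + 1) → α) → ℝ) :
    ∑ x, F x = ∑ x₀, ∑ x : Fin n → α, F (Fin.cons x₀ x) := by
  rw [← (Fin.consEquiv fun _ : Fin (n + 1) => α).sum_comp, Fintype.sum_prod_type]
  rfl

theorem CovarianceBound.pi {α β : Type*} [Fintype α] [Fintype β] {ρ : ℝ} {a : α → ℝ}
    {b : β → ℝ} {w : α → β → ℝ} (ha : ∀ x, ∑ y, w x y = a x) (hb : ∀ y, ∑ x, w x y = b y)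
    (hw : ∀ x y, 0 ≤ w x y) (h : CovarianceBound ρ a b w) (n : ℕ) :
    CovarianceBound ρ (fun x : Fin n → α => ∏ i, a (x i)) (fun y : Fin n → β => ∏ i, b (y i))
      (fun x y => ∏ i, w (x i) (y i)) := by
  induction n with
  | zero => intro φ ψ; simp
  | succ n ih =>
    intro φ ψ
    simp only [sum_fin_succ_pi n, Fin.prod_univ_succ, Fin.cons_zero, Fin.cons_succ]
    exact CovarianceBound.tensor ha hb hw h ih (fun x₀ x => φ (Fin.cons x₀ x))
      (fun y₀ y => ψ (Fin.cons y₀ y))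

theorem sum_pi_prod_eq_one {α : Type*} [Fintype α] {a : α → ℝ} (ha1 : ∑ x, a x = 1) (n : ℕ) :
    ∑ x : Fin n → α, ∏ i, a (x i) = 1 := by
  induction n with
  | zero => simp
  | succ n ih =>
    simp only [sum_fin_succ_pi n, Fin.prod_univ_succ, Fin.cons_zero, Fin.cons_succ,
      ← Finset.mul_sum, ih, mul_one, ha1]

/-- If `f` takes each value with `a`-probability at most `M`, then the probability that `f`
and `g` agree is at most `M + ρ`. -/
theorem CovarianceBound.sum_agree_le {α β Γ : Type*} [Fintype α] [Fintype β] [Fintype Γ]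
    {ρ M : ℝ} {a : α → ℝ} {b : β → ℝ} {w : α → β → ℝ} (h : CovarianceBound ρ a b w)
    (hρ : 0 ≤ ρ) (hb : ∀ y, 0 ≤ b y)
    (ha1 : ∑ x, a x = 1) (hb1 : ∑ y, b y = 1) (f : α → Γ) (g : β → Γ)
    (hM : ∀ k, ∑ x, (if f x = k then a x else 0) ≤ M) :
    ∑ x, ∑ y, (if f x = g y then w x y else 0) ≤ M + ρ := by
  have hfib : ∀ k, ∑ x, ∑ y, w x y * ((if f x = k then 1 else 0) * (if g y = k then 1 else 0)) ≤
      M * ∑ y, (if g y = k then b y else 0) +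
        ρ / 2 * (∑ x, (if f x = k then a x else 0) + ∑ y, (if g y = k then b y else 0)) := by
    intro k
    have hk := h (fun x => if f x = k then 1 else 0) (fun y => if g y = k then 1 else 0)
    simp only [ite_pow, one_pow, ne_eq, OfNat.ofNat_ne_zero, not_false_eq_true, zero_pow] at hk
    simp only [mul_ite, mul_one, mul_zero] at hk ⊢
    have hB : 0 ≤ ∑ y, (if g y = k then b y else 0) :=
      Finset.sum_nonneg fun y _ => by split_ifs <;> simp [hb]
    have h1 := mul_le_mul_of_nonneg_right (hM k) hB
    have h2 := mul_nonneg hρ (sq_nonneg (∑ x, (if f x = k then a x else 0)))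
    have h3 := mul_nonneg hρ (sq_nonneg (∑ y, (if g y = k then b y else 0)))
    linarith
  have hA : ∑ k, ∑ x, (if f x = k then a x else 0) = 1 := by
    rw [Finset.sum_comm]
    simp [ha1]
  have hB : ∑ k, ∑ y, (if g y = k then b y else 0) = 1 := by
    rw [Finset.sum_comm]
    simp [hb1]
  have hsum := Finset.sum_le_sum fun k (_ : k ∈ Finset.univ) => hfib k
  rw [Finset.sum_add_distrib, ← Finset.mul_sum, ← Finset.mul_sum, Finset.sum_add_distrib,
    hA, hB, Finset.sum_comm] at hsum
  calc ∑ x, ∑ y, (if f x = g y then w x y else 0)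
      = ∑ x, ∑ k, ∑ y,
          w x y * ((if f x = k then 1 else 0) * (if g y = k then 1 else 0)) := by
        refine Finset.sum_congr rfl fun x _ => ?_
        rw [Finset.sum_comm]
        refine Finset.sum_congr rfl fun y _ => ?_
        simp [eq_comm]
    _ ≤ M + ρ := by linarith

/-- For a bipartite source `p` on `X × Y` with full support
(`p (x, y) > 0` everywhere), there is no sequence of finite nonempty sets `Γ l`
and functions `f l : X^l → Γ l`, `g l : Y^l → Γ l` such that (1) `|Γ l| → ∞`,
(2) the probability under `p^{⊗l}` that `f l` and `g l` agree tends to `1`, and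
(3) for every sequence of values `k l ∈ Γ l` the marginal probabilities of the
preimages `f l = k l` and `g l = k l` tend to `0`. -/
theorem no_common_randomness_extraction
    {X Y : Type} [Fintype X] [Fintype Y] [Nonempty X] [Nonempty Y]
    (p : X × Y → ℝ) (hpos : ∀ xy : X × Y, 0 < p xy)
    (hsum : ∑ xy : X × Y, p xy = 1) :
    ¬ ∃ (Γ : ℕ → Type) (instΓ : ∀ l, Fintype (Γ l)) (_ : ∀ l, Nonempty (Γ l))
        (f : ∀ l, ((Fin l → X) → Γ l)) (g : ∀ l, ((Fin l → Y) → Γ l)),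
      Tendsto (fun l => @Fintype.card (Γ l) (instΓ l)) atTop atTop ∧
      Tendsto (fun l => ∑ x : Fin l → X, ∑ y : Fin l → Y,
          (if f l x = g l y then ∏ i, p (x i, y i) else 0)) atTop (nhds 1) ∧
      (∀ k : (∀ l, Γ l),
        Tendsto (fun l => ∑ x : Fin l → X,
            (if f l x = k l then ∏ i, ∑ y : Y, p (x i, y) else 0)) atTop (nhds 0) ∧
        Tendsto (fun l => ∑ y : Fin l → Y,
            (if g l y = k l then ∏ i, ∑ x : X, p (x, y i) else 0)) atTop (nhds 0)) := by
  rintro ⟨Γ, instΓ, hne, f, g, -, hagree, hsmall⟩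
  set a : X → ℝ := fun x => ∑ y, p (x, y) with ha
  set b : Y → ℝ := fun y => ∑ x, p (x, y) with hb
  have ha0 : ∀ x, 0 ≤ a x := fun x => Finset.sum_nonneg fun y _ => (hpos _).le
  have hb0 : ∀ y, 0 ≤ b y := fun y => Finset.sum_nonneg fun x _ => (hpos _).le
  have ha1 : ∑ x, a x = 1 := by rw [← hsum, Fintype.sum_prod_type]
  have hb1 : ∑ y, b y = 1 := by rw [← hsum, Fintype.sum_prod_type_right]
  obtain ⟨z, hz⟩ := Finite.exists_min p
  have hz1 : p z ≤ 1 := hsum ▸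
    Finset.single_le_sum (fun xy _ => (hpos xy).le) (Finset.mem_univ z)
  have hcov : CovarianceBound (1 - p z) a b (fun x y => p (x, y)) := by
    refine covarianceBound_of_le (fun _ => rfl) (fun _ => rfl) ha1 hb1 fun x y => ?_
    have hax : a x ≤ 1 := ha1 ▸ Finset.single_le_sum (fun x _ => ha0 x) (Finset.mem_univ x)
    have hby : b y ≤ 1 := hb1 ▸ Finset.single_le_sum (fun y _ => hb0 y) (Finset.mem_univ y)
    exact (mul_le_of_le_one_right (hpos z).le (mul_le_one₀ hax (hb0 y) hby)).trans (hz _)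
  choose k hk using fun l => Finite.exists_max
    (fun k : Γ l => ∑ x : Fin l → X, (if f l x = k then ∏ i, a (x i) else 0))
  have hlim := (hsmall k).1.add_const (1 - p z)
  have hle := le_of_tendsto_of_tendsto' hagree hlim fun l =>
    (hcov.pi (fun _ => rfl) (fun _ => rfl) (fun x y => (hpos _).le) l).sum_agree_le
      (sub_nonneg.2 hz1) (fun y => Finset.prod_nonneg fun i _ => hb0 _)
      (sum_pi_prod_eq_one ha1 l) (sum_pi_prod_eq_one hb1 l) (f l) (g l) (hk l)
  linarith [hpos z]
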